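/- Let D ≡ 1 (mod 4) be a squarefree positive integer. With u = (1,1) (i.e., E = V₀ = (1,1)^⊥), the normalized grid q_{V₀}(ℚ(√D)) in Y₁ ≅ ℝ/ℤ equals 1/2 + ℤ; while for squarefree D ≡ 2, 3 (mod 4), q_{V₀}(ℚ(√D)) = 0 + ℤ. -/

import Mathlib

open Matrix Pointwise

/-- For the lattice generated by `e` and `s • e + e'` with `e, e'` orthonormal in the plane, the
dual lattice is the union of the integer translates by `e - s • e'` of its part orthogonal
to `e`. -/
lemma dual_eq_iUnion_translates {ι : Type*} [Fintype ι] (e e' : ι → ℝ) (s : ℝ)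
    (hee : e ⬝ᵥ e = 1) (hee' : e' ⬝ᵥ e' = 1) (hort : e' ⬝ᵥ e = 0) (L Dual : Set (ι → ℝ))
    (hL : L = {x | ∃ a b : ℤ, x = ((a : ℝ) + b * s) • e + (b : ℝ) • e'})
    (hDual : Dual = {y | ∀ x ∈ L, ∃ m : ℤ, x ⬝ᵥ y = (m : ℝ)}) :
    Dual = ⋃ k : ℤ, (fun y => y + (k : ℝ) • (e - s • e')) '' (Dual ∩ {y | y ⬝ᵥ e = 0}) := by
  have hort' : e ⬝ᵥ e' = 0 := by rw [dotProduct_comm, hort]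
  have hu : ∀ x ∈ L, ∃ m : ℤ, x ⬝ᵥ (e - s • e') = (m : ℝ) := by
    rw [hL]
    rintro _ ⟨a, b, rfl⟩
    refine ⟨a, ?_⟩
    simp only [add_dotProduct, smul_dotProduct, dotProduct_sub, dotProduct_smul, hee, hee', hort,
      hort', smul_eq_mul]
    ring
  have htr : ∀ y ∈ Dual, ∀ k : ℤ, y + (k : ℝ) • (e - s • e') ∈ Dual := by
    subst hDual
    intro y hy k x hx
    obtain ⟨m, hm⟩ := hy x hx
    obtain ⟨n, hn⟩ := hu x hx
    refine ⟨m + k * n, ?_⟩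
    rw [dotProduct_add, dotProduct_smul, hm, hn, smul_eq_mul]
    push_cast
    ring
  ext y
  simp only [Set.mem_iUnion, Set.mem_image, Set.mem_inter_iff, Set.mem_ofPred_eq]
  constructor
  · intro hy
    have heL : e ∈ L := by
      rw [hL]
      exact ⟨1, 0, by simp⟩
    obtain ⟨m, hm⟩ : ∃ m : ℤ, e ⬝ᵥ y = (m : ℝ) := by
      rw [hDual] at hy
      exact hy e heL
    refine ⟨m, y + ((-m : ℤ) : ℝ) • (e - s • e'), ⟨htr y hy (-m), ?_⟩, ?_⟩
    · rw [add_dotProduct, dotProduct_comm y e, hm]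
      simp only [smul_dotProduct, sub_dotProduct, hee, hort, smul_eq_mul]
      push_cast
      ring
    · push_cast
      module
  · rintro ⟨k, z, ⟨hz, -⟩, rfl⟩
    exact htr z hz k

/-- For a squarefree `D > 1`, with `E = V₀ = (1,1)^⊥`, the normalized grid
`q_{V₀}(ℚ(√D)) ∈ Y₁ ≅ ℝ/ℤ` equals `1/2 + ℤ` when `D ≡ 1 (mod 4)` (where
`O_{ℚ(√D)} = ℤ[(1+√D)/2]`) and `0 + ℤ` when `D ≡ 2,3 (mod 4)` (where
`O_{ℚ(√D)} = ℤ[√D]`). -/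
theorem stmt_12 (D : ℕ) (hsqf : Squarefree D) (hD1 : 1 < D)
    (sD ω ω' : ℝ) (hsD : sD = Real.sqrt D) (hω : ω = (1 + sD) / 2)
    (hω' : ω' = (1 - sD) / 2)
    (Λ : Set (Fin 2 → ℝ))
    (hΛ₁ : D % 4 = 1 →
      Λ = {p | ∃ a b : ℤ, p = ![(a : ℝ) + (b : ℝ) * ω, (a : ℝ) + (b : ℝ) * ω']})
    (hΛ₂ : D % 4 = 2 ∨ D % 4 = 3 →
      Λ = {p | ∃ a b : ℤ, p = ![(a : ℝ) + (b : ℝ) * sD, (a : ℝ) - (b : ℝ) * sD]})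
    (cov : ℝ)
    (hcov₁ : D % 4 = 1 → cov = sD)
    (hcov₂ : D % 4 = 2 ∨ D % 4 = 3 → cov = 2 * sD)
    (t : ℝ) (ht : Real.exp (-t) * (Real.sqrt cov)⁻¹ * Real.sqrt 2 = 1)
    (g : (Fin 2 → ℝ) →ₗ[ℝ] (Fin 2 → ℝ))
    (hg₁ : ∀ p : Fin 2 → ℝ, p ⬝ᵥ ![1, 1] = 0 → g p = Real.exp t • p)
    (hg₂ : g ![1, 1] = Real.exp (-t) • ![(1 : ℝ), 1])
    (Λ' : Set (Fin 2 → ℝ)) (hΛ' : Λ' = g '' ((Real.sqrt cov)⁻¹ • Λ))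
    (e : Fin 2 → ℝ) (he : e = (Real.sqrt 2)⁻¹ • ![(1 : ℝ), 1])
    (Dual : Set (Fin 2 → ℝ))
    (hDual : Dual = {y | ∀ x ∈ Λ', ∃ m : ℤ, x ⬝ᵥ y = (m : ℝ)}) :
    ∃ (u' e' : Fin 2 → ℝ) (r : ℝ),
      e' ⬝ᵥ e' = 1 ∧ e' ⬝ᵥ e = 0 ∧ u' ⬝ᵥ e ≠ 0 ∧
      Dual = (⋃ k : ℤ, (fun y => y + (k : ℝ) • u') '' (Dual ∩ {y | y ⬝ᵥ e = 0})) ∧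
      u' - (u' ⬝ᵥ e) • e = r • e' ∧
      ∃ k : ℤ, r = (if D % 4 = 1 then (1 / 2 : ℝ) else 0) + (k : ℝ) := by
  have hsD0 : 0 < sD := by
    rw [hsD]
    exact Real.sqrt_pos.mpr (by exact_mod_cast (by omega : 0 < D))
  have hD4 : D % 4 = 1 ∨ D % 4 = 2 ∨ D % 4 = 3 := by
    have h4 : ¬ 4 ∣ D := fun h => by
      have := hsqf 2 (by simpa using h)
      norm_num at this
    omega
  have hw : (Real.sqrt 2)⁻¹ * (Real.sqrt 2)⁻¹ = 1 / 2 := by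
    rw [← mul_inv, Real.mul_self_sqrt (by norm_num)]
    norm_num
  have h2 : Real.sqrt 2 ≠ 0 := by positivity
  have hcov : 0 < cov := by
    rcases hD4 with h | h
    · rw [hcov₁ h]; exact hsD0
    · rw [hcov₂ h]; positivity
  have hc : (Real.sqrt cov)⁻¹ * (Real.sqrt cov)⁻¹ = cov⁻¹ := by
    rw [← mul_inv, Real.mul_self_sqrt hcov.le]
  have hminus : Real.exp (-t) * (Real.sqrt cov)⁻¹ = (Real.sqrt 2)⁻¹ := by
    exact eq_inv_of_mul_eq_one_left ht
  have hexp : Real.exp t = (Real.sqrt cov)⁻¹ * Real.sqrt 2 := by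
    have h : Real.exp t * Real.exp (-t) = 1 := by rw [← Real.exp_add]; simp
    linear_combination (-Real.exp t) * ht + (Real.sqrt cov)⁻¹ * Real.sqrt 2 * h
  have hplus : Real.exp t * (Real.sqrt cov)⁻¹ = 2 * cov⁻¹ * (Real.sqrt 2)⁻¹ := by
    have h22 : Real.sqrt 2 = 2 * (Real.sqrt 2)⁻¹ := by
      have := mul_inv_cancel₀ h2
      linear_combination (-2 * Real.sqrt 2) * hw + 2 * (Real.sqrt 2)⁻¹ * this
    rw [hexp]
    linear_combination Real.sqrt 2 * hc + cov⁻¹ * h22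
  set e' : Fin 2 → ℝ := (Real.sqrt 2)⁻¹ • ![(1 : ℝ), -1] with he'
  have hg : ∀ x y : ℝ, g ((Real.sqrt cov)⁻¹ • (x • ![(1 : ℝ), 1] + y • ![(1 : ℝ), -1])) =
      x • e + (2 * cov⁻¹ * y) • e' := by
    intro x y
    rw [map_smul, map_add, map_smul, map_smul, hg₂, hg₁ _ (by simp), he, he']
    simp only [smul_add, smul_smul]
    congr 2
    · linear_combination x * hminus
    · linear_combination y * hplus
  have hee : e ⬝ᵥ e = 1 := by
    simp [he]
    linear_combination 2 * hw
  have hee' : e' ⬝ᵥ e' = 1 := by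
    simp [he']
    linear_combination 2 * hw
  have hort : e' ⬝ᵥ e = 0 := by
    simp [he, he']
  obtain ⟨s, hs, hL⟩ : ∃ s : ℝ,
      (∃ k : ℤ, -s = (if D % 4 = 1 then (1 / 2 : ℝ) else 0) + (k : ℝ)) ∧
      Λ' = {x | ∃ a b : ℤ, x = ((a : ℝ) + b * s) • e + (b : ℝ) • e'} := by
    have himage : ∀ s v : ℝ, 2 * cov⁻¹ * v = 1 →
        Λ = {p | ∃ a b : ℤ, p = ((a : ℝ) + b * s) • ![(1 : ℝ), 1] +
          ((b : ℝ) * v) • ![(1 : ℝ), -1]} →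
        Λ' = {x | ∃ a b : ℤ, x = ((a : ℝ) + b * s) • e + (b : ℝ) • e'} := by
      intro s v hv hΛ
      have hb : ∀ b : ℝ, 2 * cov⁻¹ * (b * v) = b := fun b => by linear_combination b * hv
      rw [hΛ', hΛ]
      ext x
      constructor
      · rintro ⟨_, ⟨_, ⟨a, b, rfl⟩, rfl⟩, rfl⟩
        exact ⟨a, b, (hg _ _).trans (by rw [hb])⟩
      · rintro ⟨a, b, rfl⟩
        exact ⟨_, ⟨_, ⟨a, b, rfl⟩, rfl⟩, (hg _ _).trans (by rw [hb])⟩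
    rcases hD4 with h | h
    · refine ⟨1 / 2, ⟨-1, by rw [if_pos h]; norm_num⟩, himage _ (sD / 2) ?_ ?_⟩
      · rw [hcov₁ h]
        field_simp
      · rw [hΛ₁ h]
        ext p
        refine exists_congr fun a => exists_congr fun b => Eq.congr_right ?_
        ext i
        fin_cases i <;> simp [hω, hω'] <;> ring
    · refine ⟨0, ⟨0, by rw [if_neg (by omega)]; norm_num⟩, himage _ sD ?_ ?_⟩
      · rw [hcov₂ h]
        field_simp
      · rw [hΛ₂ h]
        ext p
        refine exists_congr fun a => exists_congr fun b => Eq.congr_right ?_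
        ext i
        fin_cases i <;> simp
        ring
  have hue : (e - s • e') ⬝ᵥ e = 1 := by
    rw [sub_dotProduct, smul_dotProduct, hee, hort, smul_zero, sub_zero]
  refine ⟨e - s • e', e', -s, hee', hort, by rw [hue]; exact one_ne_zero,
    dual_eq_iUnion_translates e e' s hee hee' hort Λ' Dual hL hDual, ?_, hs⟩
  rw [hue]
  module
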